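/- For every positive integer r there exists a constant Δ'₀ such that for every graph G = (V,E) with maximum degree Δ ≥ Δ'₀ and minimum degree δ ≥ (ln Δ)^8, there is an injective assignment v ↦ X_v of real numbers in [0,1] to the vertices such that, setting A = {v : X_v < 1/(ln Δ)^2}, B = {v : 1/(ln Δ)^2 ≤ X_v ≤ 1 − 1/(ln Δ)^3}, C = {v : X_v > 1 − 1/(ln Δ)^3}, and ordering V so that u precedes v whenever X_u < X_v, every vertex v of G satisfies: (i) d^r_A(v) ≤ 2·d(v)·Δ^{r-1}/(ln Δ)^2; (ii) d^r_C(v) ≤ 2·d(v)·Δ^{r-1}/(ln Δ)^3; (iii) (1/2)·d(v)/(ln Δ)^2 ≤ d_A(v) ≤ 2·d(v)/(ln Δ)^2; (iv) (1/2)·d(v)/(ln Δ)^3 ≤ d_C(v) ≤ 2·d(v)/(ln Δ)^3; (v) if v ∈ B then d_-(v) ≥ X_v·d(v) − √(X_v·d(v))·ln Δ; (vi) if v ∈ B then d^r_-(v) ≤ X_v·d(v)·Δ^{r-1} + √(X_v·d(v)·Δ^{r-1})·ln Δ. -/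

import Mathlib

/-- `u` is an `r`-neighbour of `v`: their distance in `G` is between `1` and `r`. -/
def IsRNbr {V : Type*} (G : SimpleGraph V) (r : ℕ) (v u : V) : Prop :=
  0 < G.dist v u ∧ G.dist v u ≤ r

open Finset

/-- Events determined by disjoint sets of coordinates are not positively correlated for the uniform
measure on a finite product. -/
theorem card_inter_mul_card_le_of_dependsOn {V κ : Type*} [Fintype V] [Fintype κ] [DecidableEq V]
    [DecidableEq κ] (S : Finset V) (A E : Finset (V → κ))
    (hA : ∀ ω ω' : V → κ, (∀ u ∈ S, ω u = ω' u) → ω ∈ A → ω' ∈ A)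
    (hE : ∀ ω ω' : V → κ, (∀ u ∉ S, ω u = ω' u) → ω ∈ E → ω' ∈ E) :
    #(A ∩ E) * Fintype.card (V → κ) ≤ #A * #E := by
  classical
  rw [← Finset.card_univ, ← Finset.card_product, ← Finset.card_product]
  refine Finset.card_le_card_of_injOn
    (fun z => (fun u => if u ∈ S then z.1 u else z.2 u, fun u => if u ∈ S then z.2 u else z.1 u))
    ?_ ?_
  · rintro ⟨a, b⟩ h
    simp only [coe_product, Set.mem_prod, mem_coe, mem_inter, mem_univ, and_true] at h ⊢
    exact ⟨hA a _ (fun u hu => by simp [hu]) h.1, hE a _ (fun u hu => by simp [hu]) h.2⟩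
  · rintro ⟨a, b⟩ _ ⟨a', b'⟩ _ h
    simp only [Prod.mk.injEq, funext_iff] at h ⊢
    refine ⟨fun u => ?_, fun u => ?_⟩ <;>
    · have h1 := h.1 u
      have h2 := h.2 u
      by_cases hu : u ∈ S <;> simp_all

/-- The points lying in none of the events `A j`, `j ∈ T`. -/
def avoiding {Ω ι : Type*} [Fintype Ω] [DecidableEq Ω] (A : ι → Finset Ω) (T : Finset ι) :
    Finset Ω :=
  {ω | ∀ j ∈ T, ω ∉ A j}

theorem mem_avoiding {Ω ι : Type*} [Fintype Ω] [DecidableEq Ω] {A : ι → Finset Ω} {T : Finset ι}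
    {ω : Ω} : ω ∈ avoiding A T ↔ ∀ j ∈ T, ω ∉ A j := by
  simp [avoiding]

/-- The symmetric Lovász local lemma, in a counting form. -/
theorem exists_forall_notMem_of_local {Ω ι : Type*} [Fintype Ω] [Nonempty Ω] [Fintype ι]
    [DecidableEq Ω] [DecidableEq ι]
    (A : ι → Finset Ω) (Γ : ι → Finset ι) (D : ℕ) (hD : 1 ≤ D) (p : ℝ) (hp : 0 ≤ p)
    (hpD : 4 * p * D ≤ 1) (hΓ : ∀ i, #(Γ i) ≤ D)
    (hind : ∀ i (T : Finset ι), Disjoint T (Γ i) →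
      (#(A i ∩ avoiding A T) : ℝ) ≤ p * #(avoiding A T)) :
    ∃ ω, ∀ i, ω ∉ A i := by
  classical
  have key : ∀ T : Finset ι, ∀ i,
      (#(A i ∩ avoiding A T) : ℝ) ≤ 2 * p * #(avoiding A T) := by
    intro T
    induction T using Finset.strongInduction with
    | H T ih =>
      intro i
      set T₂ := T \ Γ i with hT₂
      have h1 : (#(A i ∩ avoiding A T) : ℝ) ≤ #(A i ∩ avoiding A T₂) := by
        gcongr
        intro ω hω
        rw [mem_avoiding] at hω ⊢
        exact fun j hj => hω j (Finset.mem_sdiff.1 hj).1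
      have h2 := hind i T₂ Finset.sdiff_disjoint
      have h3 : ∀ j ∈ T ∩ Γ i,
          (#(A j ∩ avoiding A T₂) : ℝ) ≤ 2 * p * #(avoiding A T₂) := by
        intro j hj
        refine ih T₂ (Finset.ssubset_iff_subset_ne.2 ⟨Finset.sdiff_subset, fun h => ?_⟩) j
        rw [Finset.mem_inter] at hj
        rw [← h, hT₂, Finset.mem_sdiff] at hj
        exact hj.1.2 hj.2
      have h4 : #(avoiding A T₂) ≤ #(avoiding A T) +
          ∑ j ∈ T ∩ Γ i, #(A j ∩ avoiding A T₂) := by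
        refine le_trans (Finset.card_le_card (t := avoiding A T ∪
          (T ∩ Γ i).biUnion fun j => A j ∩ avoiding A T₂) ?_) ?_
        · intro ω hω
          simp only [mem_avoiding, mem_union, mem_biUnion, mem_inter] at hω ⊢
          by_cases h : ∀ j ∈ T, ω ∉ A j
          · exact Or.inl h
          · push Not at h
            obtain ⟨j, hj, hjA⟩ := h
            refine Or.inr ⟨j, ⟨hj, ?_⟩, hjA, hω⟩
            by_contra hjΓ
            exact hω j (by simp [hT₂, hj, hjΓ]) hjA
        · exact (Finset.card_union_le _ _).trans (by gcongr; exact Finset.card_biUnion_le)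
      have h5 : (∑ j ∈ T ∩ Γ i, #(A j ∩ avoiding A T₂) : ℝ) ≤
          D * (2 * p * #(avoiding A T₂)) := by
        refine (Finset.sum_le_sum h3).trans ?_
        rw [Finset.sum_const, nsmul_eq_mul]
        have : #(T ∩ Γ i) ≤ D := (Finset.card_le_card Finset.inter_subset_right).trans (hΓ i)
        gcongr
      have h4' : (#(avoiding A T₂) : ℝ) ≤ #(avoiding A T) +
          ∑ j ∈ T ∩ Γ i, (#(A j ∩ avoiding A T₂) : ℝ) := by exact_mod_cast h4
      have h6 : (0 : ℝ) ≤ #(avoiding A T₂) := Nat.cast_nonneg _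
      nlinarith [mul_le_mul_of_nonneg_right hpD h6]
  have hpos : ∀ T : Finset ι, 0 < #(avoiding A T) := by
    intro T
    induction T using Finset.induction_on with
    | empty => simp [avoiding, Fintype.card_pos]
    | insert i T _ ih =>
      have h1 := key T i
      have h2 : #(avoiding A T) ≤ #(avoiding A (insert i T)) +
          #(A i ∩ avoiding A T) := by
        refine le_trans (Finset.card_le_card ?_) (Finset.card_union_le _ _)
        intro ω hω
        simp only [mem_avoiding, mem_union, mem_inter, mem_insert,
          forall_eq_or_imp] at hω ⊢
        tauto
      have h2' : (#(avoiding A T) : ℝ) ≤ #(avoiding A (insert i T)) +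
          #(A i ∩ avoiding A T) := by exact_mod_cast h2
      have h3 : (0 : ℝ) < #(avoiding A T) := by exact_mod_cast ih
      have hD' : (1 : ℝ) ≤ D := by exact_mod_cast hD
      have h4 : 4 * p ≤ 1 := le_trans (le_mul_of_one_le_right (by positivity) hD') hpD
      have : (0 : ℝ) < #(avoiding A (insert i T)) := by nlinarith
      exact_mod_cast this
  obtain ⟨ω, hω⟩ := Finset.card_pos.1 (hpos univ)
  exact ⟨ω, fun i => mem_avoiding.1 hω i (mem_univ i)⟩

/-- Bound on the moment generating function of the number of coordinates `u ∈ S` of a uniformly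
random point that fall into `P u`. -/
theorem sum_exp_mul_card_le {V : Type*} [Fintype V] [DecidableEq V] {N : ℕ} (hN : 0 < N)
    (S : Finset V) (P : V → Finset (Fin N)) (t : ℝ) :
    ∑ ω : V → Fin N, Real.exp (t * #{u ∈ S | ω u ∈ P u}) ≤
      (N : ℝ) ^ Fintype.card V *
        Real.exp ((Real.exp t - 1) * ∑ u ∈ S, (#(P u) : ℝ) / N) := by
  classical
  have hN' : (0 : ℝ) < N := by exact_mod_cast hN
  have h1 : ∀ ω : V → Fin N, Real.exp (t * #{u ∈ S | ω u ∈ P u}) =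
      ∏ u, if u ∈ S ∧ ω u ∈ P u then Real.exp t else 1 := by
    intro ω
    rw [Finset.prod_ite, Finset.prod_const_one, mul_one, Finset.prod_const, ← Real.exp_nat_mul,
      mul_comm]
    congr 4
    ext u
    simp
  simp_rw [h1]
  rw [← Fintype.piFinset_univ,
    ← Finset.prod_univ_sum (fun _ : V => (univ : Finset (Fin N)))
    (fun u k => if u ∈ S ∧ k ∈ P u then Real.exp t else 1)]
  have h2 : ∀ u, ∑ k : Fin N, (if u ∈ S ∧ k ∈ P u then Real.exp t else (1 : ℝ)) ≤
      N * Real.exp (if u ∈ S then (Real.exp t - 1) * ((#(P u) : ℝ) / N) else 0) := by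
    intro u
    by_cases hu : u ∈ S
    · have : ∑ k : Fin N, (if u ∈ S ∧ k ∈ P u then Real.exp t else (1 : ℝ)) =
          N + (Real.exp t - 1) * #(P u) := by
        have h : ∀ k : Fin N, (if u ∈ S ∧ k ∈ P u then Real.exp t else (1 : ℝ)) =
            1 + (if k ∈ P u then Real.exp t - 1 else 0) := by
          intro k
          by_cases hk : k ∈ P u <;> simp [hu, hk]
        simp_rw [h]
        rw [Finset.sum_add_distrib]
        simp
        ring
      rw [this, if_pos hu]
      have := Real.add_one_le_exp ((Real.exp t - 1) * ((#(P u) : ℝ) / N))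
      calc (N : ℝ) + (Real.exp t - 1) * #(P u)
          = N * ((Real.exp t - 1) * ((#(P u) : ℝ) / N) + 1) := by field_simp; ring
        _ ≤ _ := by gcongr
    · simp [hu]
  calc _ ≤ ∏ u : V, (N * Real.exp (if u ∈ S then (Real.exp t - 1) * ((#(P u) : ℝ) / N) else 0)) :=
        Finset.prod_le_prod (fun u _ => Finset.sum_nonneg fun k _ => by positivity)
          (fun u _ => h2 u)
    _ = _ := by
        rw [Finset.prod_mul_distrib, ← Real.exp_sum, Finset.mul_sum]
        simp

theorem card_upper_tail_le {V : Type*} [Fintype V] [DecidableEq V] {N : ℕ} (hN : 0 < N)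
    (S : Finset V) (P : V → Finset (Fin N)) {x M L : ℝ} (hL : 1 ≤ L) (hxM : L ^ 2 ≤ x * M)
    (hSM : (#S : ℝ) ≤ M) (hMN : M ≤ N) (hP : ∀ u, (#(P u) : ℝ) ≤ x * N + 1) :
    (#{ω : V → Fin N | x * M + √(x * M) * L < #{u ∈ S | ω u ∈ P u}} : ℝ) ≤
      (N : ℝ) ^ Fintype.card V * Real.exp (2 - L ^ 2 / 4) := by
  have hN' : (0 : ℝ) < N := by exact_mod_cast hN
  have hM0 : 0 ≤ M := le_trans (Nat.cast_nonneg _) hSM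
  have hx0 : 0 ≤ x := by
    by_contra h
    nlinarith
  set s := √(x * M) with hs
  have hs2 : s ^ 2 = x * M := Real.sq_sqrt (by positivity)
  have hsL : L ≤ s := Real.le_sqrt_of_sq_le hxM
  have hs0 : 0 < s := by linarith
  set t := L / (2 * s) with ht
  have ht0 : 0 < t := by positivity
  have hts : t * s = L / 2 := by rw [ht]; field_simp
  have ht1 : t ≤ 1 / 2 := by
    rw [ht, div_le_iff₀ (by positivity)]
    linarith
  have ht2 : t ^ 2 ≤ 1 / 4 := by nlinarith
  clear_value s t
  have hexp : Real.exp t - 1 ≤ t + t ^ 2 := by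
    have := (abs_le.1 (Real.abs_exp_sub_one_sub_id_le (x := t)
      (by rw [abs_le]; constructor <;> linarith))).2
    linarith
  have hsum : ∑ u ∈ S, (#(P u) : ℝ) / N ≤ s ^ 2 + 1 := by
    calc ∑ u ∈ S, (#(P u) : ℝ) / N ≤ ∑ u ∈ S, (x + 1 / N) := by
          refine Finset.sum_le_sum fun u _ => ?_
          rw [div_le_iff₀ hN', add_mul, one_div, inv_mul_cancel₀ hN'.ne']
          exact hP u
      _ = #S * (x + 1 / N) := by rw [Finset.sum_const, nsmul_eq_mul]
      _ ≤ M * (x + 1 / N) := by gcongr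
      _ = x * M + M / N := by ring
      _ ≤ s ^ 2 + 1 := by rw [hs2]; gcongr; exact (div_le_one hN').2 hMN
  have hmgf := sum_exp_mul_card_le hN S P t
  have hmarkov : (#{ω : V → Fin N | x * M + s * L < #{u ∈ S | ω u ∈ P u}} : ℝ) *
      Real.exp (t * (x * M + s * L)) ≤ ∑ ω : V → Fin N, Real.exp (t * #{u ∈ S | ω u ∈ P u}) := by
    rw [← nsmul_eq_mul, ← Finset.sum_const]
    refine (Finset.sum_le_sum fun ω hω => ?_).trans
      (Finset.sum_le_sum_of_subset_of_nonneg (Finset.filter_subset _ _)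
        fun _ _ _ => (Real.exp_pos _).le)
    have := (Finset.mem_filter.1 hω).2
    gcongr
  have hE : (Real.exp t - 1) * ∑ u ∈ S, (#(P u) : ℝ) / N ≤
      (2 - L ^ 2 / 4) + t * (x * M + s * L) := by
    have h0 : 0 ≤ ∑ u ∈ S, (#(P u) : ℝ) / N := Finset.sum_nonneg fun u _ => by positivity
    calc _ ≤ (t + t ^ 2) * (s ^ 2 + 1) := by gcongr
      _ = t * s ^ 2 + (t * s) ^ 2 + t + t ^ 2 := by ring
      _ ≤ (2 - L ^ 2 / 4) + (t * s ^ 2 + (t * s) * L) := by rw [hts]; linarith [sq_nonneg t]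
      _ = _ := by rw [hs2]; ring
  refine le_of_mul_le_mul_right ?_ (Real.exp_pos (t * (x * M + s * L)))
  rw [mul_assoc, ← Real.exp_add]
  exact hmarkov.trans (hmgf.trans (by gcongr))

theorem card_lower_tail_le {V : Type*} [Fintype V] [DecidableEq V] {N : ℕ} (hN : 0 < N)
    (S : Finset V) (P : V → Finset (Fin N)) {x L : ℝ} (hL : 1 ≤ L) (hxS : L ^ 2 ≤ x * #S)
    (hSN : (#S : ℝ) ≤ N) (hP : ∀ u, x * N - 1 ≤ (#(P u) : ℝ)) :
    (#{ω : V → Fin N | (#{u ∈ S | ω u ∈ P u} : ℝ) < x * #S - √(x * #S) * L} : ℝ) ≤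
      (N : ℝ) ^ Fintype.card V * Real.exp (2 - L ^ 2 / 4) := by
  have hN' : (0 : ℝ) < N := by exact_mod_cast hN
  set s := √(x * #S) with hs
  have hs2 : s ^ 2 = x * #S := Real.sq_sqrt (by nlinarith)
  have hsL : L ≤ s := Real.le_sqrt_of_sq_le hxS
  have hs0 : 0 < s := by linarith
  set t := L / (2 * s) with ht
  have ht0 : 0 < t := by positivity
  have hts : t * s = L / 2 := by rw [ht]; field_simp
  have ht1 : t ≤ 1 / 2 := by
    rw [ht, div_le_iff₀ (by positivity)]
    linarith
  have ht2 : t ^ 2 ≤ 1 / 4 := by nlinarith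
  clear_value s t
  have hexp : Real.exp (-t) - 1 ≤ -t + t ^ 2 := by
    have := (abs_le.1 (Real.abs_exp_sub_one_sub_id_le (x := -t)
      (by rw [abs_le]; constructor <;> linarith))).2
    nlinarith
  have hsum : s ^ 2 - 1 ≤ ∑ u ∈ S, (#(P u) : ℝ) / N := by
    calc s ^ 2 - 1 ≤ x * #S - #S / N := by
          rw [hs2]; gcongr; exact (div_le_one hN').2 hSN
      _ = #S * (x - 1 / N) := by ring
      _ = ∑ u ∈ S, (x - 1 / N) := by rw [Finset.sum_const, nsmul_eq_mul]
      _ ≤ ∑ u ∈ S, (#(P u) : ℝ) / N := by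
          refine Finset.sum_le_sum fun u _ => ?_
          rw [le_div_iff₀ hN', sub_mul, one_div, inv_mul_cancel₀ hN'.ne']
          exact hP u
  have hmgf := sum_exp_mul_card_le hN S P (-t)
  have hmarkov : (#{ω : V → Fin N | (#{u ∈ S | ω u ∈ P u} : ℝ) < x * #S - s * L} : ℝ) *
      Real.exp (-t * (x * #S - s * L)) ≤
        ∑ ω : V → Fin N, Real.exp (-t * #{u ∈ S | ω u ∈ P u}) := by
    rw [← nsmul_eq_mul, ← Finset.sum_const]
    refine (Finset.sum_le_sum fun ω hω => ?_).trans
      (Finset.sum_le_sum_of_subset_of_nonneg (Finset.filter_subset _ _)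
        fun _ _ _ => (Real.exp_pos _).le)
    have := (Finset.mem_filter.1 hω).2
    rw [Real.exp_le_exp]
    nlinarith
  have hE : (Real.exp (-t) - 1) * ∑ u ∈ S, (#(P u) : ℝ) / N ≤
      (2 - L ^ 2 / 4) + -t * (x * #S - s * L) := by
    have h0 : 0 ≤ ∑ u ∈ S, (#(P u) : ℝ) / N := Finset.sum_nonneg fun u _ => by positivity
    calc _ ≤ (-t + t ^ 2) * ∑ u ∈ S, (#(P u) : ℝ) / N := by gcongr
      _ ≤ (-t + t ^ 2) * (s ^ 2 - 1) := mul_le_mul_of_nonpos_left hsum (by nlinarith)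
      _ = -t * s ^ 2 + (t * s) ^ 2 + t - t ^ 2 := by ring
      _ ≤ (2 - L ^ 2 / 4) + (-t * s ^ 2 + (t * s) * L) := by rw [hts]; linarith [sq_nonneg t]
      _ = _ := by rw [hs2]; ring
  refine le_of_mul_le_mul_right ?_ (Real.exp_pos (-t * (x * #S - s * L)))
  rw [mul_assoc, ← Real.exp_add]
  exact hmarkov.trans (hmgf.trans (by gcongr))

/-- Simultaneous concentration, obtained from the local lemma. Given for every `v` a family of tests
`t`, each recording for every coordinate `u` whether it falls into `P v t u`, a set of density
about `x v t`, some point has on every test about the expected number of hits among the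
coordinates in `S v` and `S' v`. -/
theorem exists_forall_concentrated {V τ : Type*} [Fintype V] [DecidableEq V] [Fintype τ] {N : ℕ}
    (hN : 0 < N) (S S' : V → Finset V) (hsub : ∀ v, S' v ⊆ S v)
    (hsymm : ∀ u v, u ∈ S v → v ∈ S u) (M : V → ℝ) (hSM : ∀ v, (#(S v) : ℝ) ≤ M v)
    (hMN : ∀ v, M v ≤ N) (x : V → τ → ℝ) (P : V → τ → V → Finset (Fin N))
    (hP : ∀ v t u, |(#(P v t u) : ℝ) - x v t * N| ≤ 1) {L : ℝ} (hL : 1 ≤ L)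
    (hτ : Fintype.card τ ≤ N + 2) (hp : 36 * (N : ℝ) ^ 3 * Real.exp (2 - L ^ 2 / 4) ≤ 1) :
    ∃ ω : V → Fin N, ∀ v t, L ^ 2 ≤ x v t * #(S' v) →
      (#{u ∈ S v | ω u ∈ P v t u} : ℝ) ≤ x v t * M v + √(x v t * M v) * L ∧
      (#{u ∈ S' v | ω u ∈ P v t u} : ℝ) ≤ x v t * #(S' v) + √(x v t * #(S' v)) * L ∧
      x v t * #(S' v) - √(x v t * #(S' v)) * L ≤ #{u ∈ S' v | ω u ∈ P v t u} := by
  classical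
  have : NeZero N := ⟨hN.ne'⟩
  have hN1 : (1 : ℝ) ≤ N := by exact_mod_cast hN
  let U : V → τ → Finset (V → Fin N) := fun v t =>
    {ω | x v t * M v + √(x v t * M v) * L < #{u ∈ S v | ω u ∈ P v t u}}
  let U' : V → τ → Finset (V → Fin N) := fun v t =>
    {ω | x v t * #(S' v) + √(x v t * #(S' v)) * L < #{u ∈ S' v | ω u ∈ P v t u}}
  let W : V → τ → Finset (V → Fin N) := fun v t =>
    {ω | (#{u ∈ S' v | ω u ∈ P v t u} : ℝ) < x v t * #(S' v) - √(x v t * #(S' v)) * L}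
  let A : V → Finset (V → Fin N) := fun v =>
    ({t | L ^ 2 ≤ x v t * #(S' v)} : Finset τ).biUnion fun t => U v t ∪ (U' v t ∪ W v t)
  let Γ : V → Finset V := fun v => (S v).biUnion S
  set q : ℝ := Real.exp (2 - L ^ 2 / 4) with hq
  have hq0 : 0 < q := Real.exp_pos _
  have hS_nat : ∀ v, #(S v) ≤ N := fun v => by exact_mod_cast (hSM v).trans (hMN v)
  have hsub_card : ∀ v, (#(S' v) : ℝ) ≤ #(S v) := fun v => by
    exact_mod_cast Finset.card_le_card (hsub v)
  have hA_card : ∀ v, (#(A v) : ℝ) ≤ (3 * (N + 2) * q) * (N : ℝ) ^ Fintype.card V := by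
    intro v
    have h1 : #(A v) ≤ ∑ t with L ^ 2 ≤ x v t * #(S' v), (#(U v t) + (#(U' v t) + #(W v t))) :=
      Finset.card_biUnion_le.trans (Finset.sum_le_sum fun t _ =>
        (Finset.card_union_le _ _).trans (by gcongr; exact Finset.card_union_le _ _))
    have h2 : ∀ t ∈ ({t | L ^ 2 ≤ x v t * #(S' v)} : Finset τ),
        (#(U v t) + (#(U' v t) + #(W v t)) : ℝ) ≤ 3 * ((N : ℝ) ^ Fintype.card V * q) := by
      intro t ht
      have ht := (Finset.mem_filter.1 ht).2
      have hx0 : 0 ≤ x v t := by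
        by_contra h
        nlinarith [Nat.cast_nonneg (α := ℝ) #(S' v)]
      have hPu := fun u => (abs_le.1 (hP v t u))
      have e1 : (#(U v t) : ℝ) ≤ (N : ℝ) ^ Fintype.card V * q :=
        card_upper_tail_le hN (S v) (P v t) hL
          (ht.trans (by gcongr; exact (hsub_card v).trans (hSM v))) (hSM v) (hMN v)
          (fun u => by linarith [(hPu u).2])
      have e2 : (#(U' v t) : ℝ) ≤ (N : ℝ) ^ Fintype.card V * q :=
        card_upper_tail_le hN (S' v) (P v t) hL ht le_rfl
          ((hsub_card v).trans ((hSM v).trans (hMN v))) (fun u => by linarith [(hPu u).2])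
      have e3 : (#(W v t) : ℝ) ≤ (N : ℝ) ^ Fintype.card V * q :=
        card_lower_tail_le hN (S' v) (P v t) hL ht
          ((hsub_card v).trans ((hSM v).trans (hMN v))) (fun u => by linarith [(hPu u).1])
      linarith
    have h3 : (#(A v) : ℝ) ≤
        ∑ t with L ^ 2 ≤ x v t * #(S' v), (#(U v t) + (#(U' v t) + #(W v t)) : ℝ) := by
      exact_mod_cast h1
    refine (h3.trans (Finset.sum_le_sum h2)).trans ?_
    rw [Finset.sum_const, nsmul_eq_mul]
    have h4 : (#({t | L ^ 2 ≤ x v t * #(S' v)} : Finset τ) : ℝ) ≤ N + 2 := by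
      exact_mod_cast (Finset.card_le_univ _).trans hτ
    calc _ ≤ (N + 2 : ℝ) * (3 * ((N : ℝ) ^ Fintype.card V * q)) := by gcongr
      _ = _ := by ring
  have hdep : ∀ v (ω ω' : V → Fin N), (∀ u ∈ S v, ω u = ω' u) → ω ∈ A v → ω' ∈ A v := by
    intro v ω ω' h hω
    have e1 : ∀ t, #{u ∈ S v | ω' u ∈ P v t u} = #{u ∈ S v | ω u ∈ P v t u} := fun t => by
      congr 1
      exact Finset.filter_congr fun u hu => by rw [h u hu]
    have e2 : ∀ t, #{u ∈ S' v | ω' u ∈ P v t u} = #{u ∈ S' v | ω u ∈ P v t u} := fun t => by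
      congr 1
      exact Finset.filter_congr fun u hu => by rw [h u (hsub v hu)]
    simp only [A, U, U', W, mem_biUnion, mem_union, mem_filter, mem_univ, true_and] at hω ⊢
    simpa only [e1, e2] using hω
  obtain ⟨ω, hω⟩ := exists_forall_notMem_of_local A Γ (N ^ 2) (Nat.one_le_pow _ _ hN)
    (3 * (N + 2) * q) (by positivity) (by
      push_cast
      have h : (N + 2 : ℝ) ≤ 3 * N := by linarith
      calc 4 * (3 * (N + 2) * q) * (N : ℝ) ^ 2 ≤ 4 * (3 * (3 * N) * q) * (N : ℝ) ^ 2 := by gcongr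
        _ = 36 * (N : ℝ) ^ 3 * q := by ring
        _ ≤ 1 := hp)
    (fun v => by
      refine (Finset.card_biUnion_le_card_mul _ _ N fun u _ => hS_nat u).trans ?_
      rw [sq]
      exact Nat.mul_le_mul_right _ (hS_nat v))
    (fun v T hT => by
      have h := card_inter_mul_card_le_of_dependsOn (S v) (A v) (avoiding A T) (hdep v) (by
        intro ω ω' h hω
        rw [mem_avoiding] at hω ⊢
        intro w hw hw'
        refine hω w hw (hdep w ω' ω (fun u hu => (h u fun huv => ?_).symm) hw')
        exact Finset.disjoint_left.1 hT hw (Finset.mem_biUnion.2 ⟨u, huv, hsymm _ _ hu⟩))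
      have hc : (Fintype.card (V → Fin N) : ℝ) = (N : ℝ) ^ Fintype.card V := by simp
      have h' : (#(A v ∩ avoiding A T) : ℝ) * (N : ℝ) ^ Fintype.card V ≤
          #(A v) * #(avoiding A T) := by
        rw [← hc]
        exact_mod_cast h
      refine le_of_mul_le_mul_right (h'.trans ?_)
        (show (0 : ℝ) < (N : ℝ) ^ Fintype.card V by positivity)
      calc _ ≤ (3 * (N + 2) * q) * (N : ℝ) ^ Fintype.card V * #(avoiding A T) := by
            gcongr
            exact hA_card v
        _ = _ := by ring)
  refine ⟨ω, fun v t ht => ?_⟩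
  have h := hω v
  simp only [A, U, U', W, mem_biUnion, mem_union, mem_filter, mem_univ, true_and, not_exists,
    not_and, not_or, not_lt] at h
  exact h t ht

theorem abs_card_filter_sub_le {N : ℕ} (Q : Finset (Fin N)) {θ z : ℝ} (hθ0 : 0 ≤ θ) (hθ1 : θ < 1)
    (hz0 : 0 ≤ z) (hzN : z ≤ N) (hle : ∀ j ∈ Q, (j : ℝ) + θ ≤ z)
    (hlt : ∀ j : Fin N, (j : ℝ) + θ < z → j ∈ Q) : |(#Q : ℝ) - z| ≤ 1 := by
  have h1 : #Q ≤ ⌊z⌋₊ + 1 := by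
    rw [← Finset.card_map Fin.valEmbedding, ← Finset.card_range (⌊z⌋₊ + 1)]
    refine Finset.card_le_card fun i hi => ?_
    obtain ⟨j, hj, rfl⟩ := Finset.mem_map.1 hi
    rw [Finset.mem_range, Nat.lt_succ_iff]
    exact Nat.le_floor (by have := hle j hj; simp only [Fin.valEmbedding_apply]; linarith)
  have h2 : ⌊z⌋₊ ≤ #Q := by
    rw [← Finset.card_map Fin.valEmbedding, ← Finset.card_range ⌊z⌋₊]
    refine Finset.card_le_card fun i hi => ?_
    have hi := Finset.mem_range.1 hi
    have hiz : ((i + 1 : ℕ) : ℝ) ≤ z := (Nat.le_floor_iff hz0).1 hi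
    push_cast at hiz
    have hiN : i < N := by
      have : (i : ℝ) < N := by linarith
      exact_mod_cast this
    exact Finset.mem_map.2 ⟨⟨i, hiN⟩, hlt _ (by simp only; linarith), rfl⟩
  have h1' : (#Q : ℝ) ≤ ⌊z⌋₊ + 1 := by exact_mod_cast h1
  have h2' : (⌊z⌋₊ : ℝ) ≤ #Q := by exact_mod_cast h2
  have := Nat.floor_le hz0
  have := Nat.lt_floor_add_one z
  rw [abs_le]
  constructor <;> linarith

theorem exists_adj_dist_add_one_eq {V : Type*} (G : SimpleGraph V) {v u : V}
    (h : 0 < G.dist v u) : ∃ w, G.Adj w u ∧ G.dist v w + 1 = G.dist v u := by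
  have hr := SimpleGraph.Reachable.of_dist_ne_zero h.ne'
  obtain ⟨p, hp⟩ := hr.symm.exists_walk_length_eq_dist
  cases p with
  | nil => simp at h
  | cons hadj p =>
    rename_i w
    refine ⟨w, hadj.symm, ?_⟩
    rw [SimpleGraph.dist_comm (u := v) (v := u), ← hp, SimpleGraph.Walk.length_cons]
    have h1 : G.dist v w ≤ p.length := by
      rw [SimpleGraph.dist_comm]
      exact SimpleGraph.dist_le p
    have h2 : G.dist v u ≤ G.dist v w + 1 := by
      obtain ⟨p', hp'⟩ := (hr.trans hadj.reachable).exists_walk_length_eq_dist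
      rw [← hp']
      simpa using SimpleGraph.dist_le (p'.concat hadj.symm)
    rw [SimpleGraph.dist_comm (u := v) (v := u), ← hp, SimpleGraph.Walk.length_cons] at h2
    omega

open Classical in
theorem card_isRNbr_le {V : Type*} [Fintype V] (G : SimpleGraph V) [DecidableRel G.Adj] (v : V)
    (r : ℕ) :
    #{u | IsRNbr G (r + 1) v u} ≤ G.degree v * G.maxDegree ^ r := by
  induction r with
  | zero =>
    rw [pow_zero, mul_one, ← SimpleGraph.card_neighborFinset_eq_degree]
    refine Finset.card_le_card fun u hu => ?_
    have hu := (Finset.mem_filter.1 hu).2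
    rw [SimpleGraph.mem_neighborFinset, ← SimpleGraph.dist_eq_one_iff_adj]
    have := hu.1
    have := hu.2
    omega
  | succ r ih =>
    have hcover : ({u | IsRNbr G (r + 1 + 1) v u} : Finset V) ⊆ G.neighborFinset v ∪
        ({w | IsRNbr G (r + 1) v w} : Finset V).biUnion fun w =>
          {u ∈ G.neighborFinset w | G.dist v u = G.dist v w + 1} := by
      intro u hu
      obtain ⟨h0, hu⟩ := (Finset.mem_filter.1 hu).2
      obtain ⟨w, hw, hd⟩ := exists_adj_dist_add_one_eq G h0
      rcases Nat.eq_zero_or_pos (G.dist v w) with h | h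
      · refine Finset.mem_union_left _ ?_
        rw [SimpleGraph.mem_neighborFinset, ← SimpleGraph.dist_eq_one_iff_adj]
        omega
      · refine Finset.mem_union_right _ (Finset.mem_biUnion.2 ⟨w, ?_, ?_⟩)
        · exact Finset.mem_filter.2 ⟨Finset.mem_univ _, h, by omega⟩
        · simp [hw, hd]
    have hout : ∀ w ∈ ({w | IsRNbr G (r + 1) v w} : Finset V),
        #{u ∈ G.neighborFinset w | G.dist v u = G.dist v w + 1} ≤ G.maxDegree - 1 := by
      intro w hw
      obtain ⟨w', hw', hd⟩ := exists_adj_dist_add_one_eq G (Finset.mem_filter.1 hw).2.1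
      have : #{u ∈ G.neighborFinset w | G.dist v u = G.dist v w + 1} < #(G.neighborFinset w) := by
        refine Finset.card_lt_card (Finset.filter_ssubset.2 ⟨w', ?_, by omega⟩)
        simpa using hw'.symm
      have hdeg := G.degree_le_maxDegree w
      rw [SimpleGraph.card_neighborFinset_eq_degree] at this
      omega
    have h1 := (Finset.card_le_card hcover).trans (Finset.card_union_le _ _)
    have h2 := Finset.card_biUnion_le_card_mul _ _ _ hout
    rw [SimpleGraph.card_neighborFinset_eq_degree] at h1
    rcases Nat.eq_zero_or_pos G.maxDegree with h | h
    · have := G.degree_le_maxDegree v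
      have hv : G.degree v = 0 := by omega
      rw [hv, zero_mul, Nat.le_zero] at ih
      rw [ih] at h2
      omega
    · obtain ⟨m, hm⟩ : ∃ m, G.maxDegree = m + 1 := ⟨G.maxDegree - 1, by omega⟩
      rw [hm] at h2 ih ⊢
      rw [Nat.add_sub_cancel] at h2
      have h3 := Nat.mul_le_mul_right m ih
      have h4 : G.degree v ≤ G.degree v * (m + 1) ^ r := Nat.le_mul_of_pos_right _ (by positivity)
      calc _ ≤ _ := h1
        _ ≤ G.degree v * (m + 1) ^ r + G.degree v * (m + 1) ^ r * m := by omega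
        _ = _ := by ring

theorem thirty_six_mul_exp_le_one {r L : ℝ} (hr : 1 ≤ r) (hL : 12 * r + 8 ≤ L) :
    36 * Real.exp (r * L) ^ 3 * Real.exp (2 - L ^ 2 / 4) ≤ 1 := by
  have h36 : (36 : ℝ) ≤ Real.exp 4 := by
    have h1 : (2.7 : ℝ) ≤ Real.exp 1 := by linarith [Real.exp_one_gt_d9]
    have h2 : Real.exp 4 = Real.exp 1 ^ 4 := by rw [← Real.exp_nat_mul]; norm_num
    rw [h2]
    calc (36 : ℝ) ≤ 2.7 ^ 4 := by norm_num
      _ ≤ _ := by gcongr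
  calc 36 * Real.exp (r * L) ^ 3 * Real.exp (2 - L ^ 2 / 4)
      ≤ Real.exp 4 * Real.exp (r * L) ^ 3 * Real.exp (2 - L ^ 2 / 4) := by gcongr
    _ = Real.exp (4 + 3 * (r * L) + (2 - L ^ 2 / 4)) := by
        rw [Real.exp_add, Real.exp_add, ← Real.exp_nat_mul]
        norm_num
    _ ≤ 1 := Real.exp_le_one_iff.2 (by nlinarith)

/-- Once the expectation is at least `4 * L ^ 2`, a deviation of `L` standard deviations changes it
by a factor of at most two. -/
theorem sqrt_mul_le_half {μ L : ℝ} (hμ : 4 * L ^ 2 ≤ μ) : √μ * L ≤ μ / 2 := by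
  have hμ0 : 0 ≤ μ := le_trans (by positivity) hμ
  have h1 : 2 * L ≤ √μ := Real.le_sqrt_of_sq_le (by linarith)
  nlinarith [Real.sq_sqrt hμ0, Real.sqrt_nonneg μ]

theorem exists_good_vertex_ordering (r : ℕ) (hr : 1 ≤ r) :
    ∃ Δ₀ : ℝ, ∀ (V : Type) [Fintype V] [DecidableEq V],
      ∀ (G : SimpleGraph V) [DecidableRel G.Adj],
      Δ₀ ≤ (G.maxDegree : ℝ) →
      (Real.log G.maxDegree) ^ 8 ≤ (G.minDegree : ℝ) →
      ∃ X : V → ℝ, Function.Injective X ∧ (∀ v, X v ∈ Set.Icc (0 : ℝ) 1) ∧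
        -- the classes `A`, `B`, `C` determined by `X`
        (letI Δ : ℝ := G.maxDegree
         letI A : Set V := {v | X v < 1 / (Real.log Δ) ^ 2}
         letI B : Set V := {v | 1 / (Real.log Δ) ^ 2 ≤ X v ∧ X v ≤ 1 - 1 / (Real.log Δ) ^ 3}
         letI C : Set V := {v | 1 - 1 / (Real.log Δ) ^ 3 < X v}
         ∀ v : V,
          -- (i)
          (({u | u ∈ A ∧ IsRNbr G r v u}.ncard : ℝ) ≤
            2 * G.degree v * Δ ^ (r - 1) / (Real.log Δ) ^ 2) ∧
          -- (ii)
          (({u | u ∈ C ∧ IsRNbr G r v u}.ncard : ℝ) ≤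
            2 * G.degree v * Δ ^ (r - 1) / (Real.log Δ) ^ 3) ∧
          -- (iii)
          ((1 / 2 : ℝ) * G.degree v / (Real.log Δ) ^ 2 ≤ ({u | u ∈ A ∧ G.Adj v u}.ncard : ℝ) ∧
            ({u | u ∈ A ∧ G.Adj v u}.ncard : ℝ) ≤ 2 * G.degree v / (Real.log Δ) ^ 2) ∧
          -- (iv)
          ((1 / 2 : ℝ) * G.degree v / (Real.log Δ) ^ 3 ≤ ({u | u ∈ C ∧ G.Adj v u}.ncard : ℝ) ∧
            ({u | u ∈ C ∧ G.Adj v u}.ncard : ℝ) ≤ 2 * G.degree v / (Real.log Δ) ^ 3) ∧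
          -- (v): backward neighbours (those preceding `v` in the ordering given by `X`)
          (v ∈ B →
            X v * G.degree v - Real.sqrt (X v * G.degree v) * Real.log Δ ≤
              ({u | G.Adj v u ∧ X u < X v}.ncard : ℝ)) ∧
          -- (vi): backward r-neighbours
          (v ∈ B →
            ({u | IsRNbr G r v u ∧ X u < X v}.ncard : ℝ) ≤
              X v * G.degree v * Δ ^ (r - 1) +
                Real.sqrt (X v * G.degree v * Δ ^ (r - 1)) * Real.log Δ)) := by
  classical
  refine ⟨Real.exp (12 * r + 8), ?_⟩
  intro V _ _ G _ hΔ hδ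
  set L : ℝ := Real.log G.maxDegree with hLdef
  have hr1 : (1 : ℝ) ≤ r := by exact_mod_cast hr
  have hΔpos : (0 : ℝ) < G.maxDegree := (Real.exp_pos _).trans_le hΔ
  have hΔnat : 0 < G.maxDegree := by exact_mod_cast hΔpos
  have hL : 12 * (r : ℝ) + 8 ≤ L := (Real.le_log_iff_exp_le hΔpos).2 hΔ
  have hL20 : 20 ≤ L := by linarith
  have hL0 : 0 < L := by linarith
  have hexpL : Real.exp L = G.maxDegree := Real.exp_log hΔpos
  clear_value L
  have hd : ∀ v, L ^ 8 ≤ (G.degree v : ℝ) := fun v =>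
    hδ.trans (by exact_mod_cast G.minDegree_le_degree v)
  set N : ℕ := G.maxDegree ^ r with hNdef
  have hN : 0 < N := by positivity
  have hN' : (0 : ℝ) < N := by exact_mod_cast hN
  have hNexp : (N : ℝ) = Real.exp (r * L) := by
    rw [Real.exp_nat_mul, hexpL, hNdef]
    push_cast
    rfl
  -- distinct offsets, which make the values of `X` distinct
  let e := Fintype.equivFin V
  let θ : V → ℝ := fun v => (e v : ℝ) / Fintype.card V
  have hcardV : ∀ _ : V, (0 : ℝ) < Fintype.card V := fun v => by
    exact_mod_cast Fintype.card_pos_iff.2 ⟨v⟩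
  have hθ0 : ∀ v, 0 ≤ θ v := fun v => by positivity
  have hθ1 : ∀ v, θ v < 1 := fun v => by
    rw [div_lt_one (hcardV v)]
    exact_mod_cast (e v).2
  let pt : V → Fin N → ℝ := fun v k => ((k : ℝ) + θ v) / N
  have hpt0 : ∀ v k, 0 ≤ pt v k := fun v k => by
    have := hθ0 v
    positivity
  have hpt1 : ∀ v k, pt v k ≤ 1 := fun v k => by
    rw [div_le_one hN']
    have h : ((k : ℕ) + 1 : ℝ) ≤ N := by exact_mod_cast k.2
    linarith [hθ1 v]
  have hpt_inj : ∀ u v j k, pt u j = pt v k → u = v := by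
    intro u v j k h
    have h : (j : ℝ) + θ u = k + θ v := by
      have := congrArg (· * (N : ℝ)) h
      simpa [pt, div_mul_cancel₀ _ hN'.ne'] using this
    have hjk : (j : ℕ) = k := by
      have h1 : (j : ℝ) < k + 1 := by linarith [hθ0 u, hθ1 v]
      have h2 : (k : ℝ) < j + 1 := by linarith [hθ0 v, hθ1 u]
      have h1 : (j : ℕ) < k + 1 := by exact_mod_cast h1
      have h2 : (k : ℕ) < j + 1 := by exact_mod_cast h2
      omega
    rw [hjk] at h
    have hθ : θ u = θ v := by linarith
    have hc := (hcardV u).ne'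
    have : ((e u : ℕ) : ℝ) = (e v : ℕ) := by
      simpa [θ, div_left_inj' hc] using hθ
    exact e.injective (Fin.ext (by exact_mod_cast this))
  have hbelow : ∀ (y : ℝ), 0 ≤ y → y ≤ 1 → ∀ u,
      |(#({j : Fin N | pt u j < y} : Finset (Fin N)) : ℝ) - y * N| ≤ 1 := by
    intro y hy0 hy1 u
    have hiff : ∀ j, pt u j < y ↔ (j : ℝ) + θ u < y * N := fun j => div_lt_iff₀ hN'
    refine abs_card_filter_sub_le _ (hθ0 u) (hθ1 u) (by positivity)
      (mul_le_of_le_one_left hN'.le hy1) (fun j hj => ?_) (fun j hj => ?_)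
    · exact ((hiff j).1 (Finset.mem_filter.1 hj).2).le
    · exact Finset.mem_filter.2 ⟨Finset.mem_univ _, (hiff j).2 hj⟩
  have habove : ∀ (y : ℝ), 0 ≤ y → y ≤ 1 → ∀ u,
      |(#({j : Fin N | 1 - y < pt u j} : Finset (Fin N)) : ℝ) - y * N| ≤ 1 := by
    intro y hy0 hy1 u
    have hiff : ∀ j, pt u j ≤ 1 - y ↔ (j : ℝ) + θ u ≤ (1 - y) * N := fun j => div_le_iff₀ hN'
    have h := abs_card_filter_sub_le ({j : Fin N | ¬ 1 - y < pt u j} : Finset (Fin N))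
      (z := (1 - y) * N) (hθ0 u) (hθ1 u) (mul_nonneg (by linarith) hN'.le)
      (mul_le_of_le_one_left hN'.le (by linarith))
      (fun j hj => (hiff j).1 (not_lt.1 (Finset.mem_filter.1 hj).2))
      (fun j hj => Finset.mem_filter.2 ⟨Finset.mem_univ _, not_lt.2 ((hiff j).2 hj.le)⟩)
    have hc := Finset.card_filter_add_card_filter_not (s := (univ : Finset (Fin N)))
      (fun j => 1 - y < pt u j)
    rw [Finset.card_univ, Fintype.card_fin] at hc
    have hc' : (#({j : Fin N | 1 - y < pt u j} : Finset (Fin N)) : ℝ) +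
      #({j : Fin N | ¬ 1 - y < pt u j} : Finset (Fin N)) = N := by exact_mod_cast hc
    rw [abs_le] at h ⊢
    constructor <;> linarith [h.1, h.2]
  have hL2 : 1 / L ^ 2 ≤ 1 := by
    rw [div_le_one (by positivity)]
    nlinarith
  have hL3 : 1 / L ^ 3 ≤ 1 := by
    rw [div_le_one (by positivity)]
    exact one_le_pow₀ (by linarith)
  -- the tests: thresholds at a possible value of `X v`, and the classes `A` and `C`
  let x : V → Fin N ⊕ Bool → ℝ := fun v t =>
    t.elim (fun k => pt v k) (fun b => bif b then 1 / L ^ 3 else 1 / L ^ 2)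
  let P : V → Fin N ⊕ Bool → V → Finset (Fin N) := fun v t u =>
    t.elim (fun k => univ.filter fun j => pt u j < pt v k)
      (fun b => bif b then univ.filter fun j => 1 - 1 / L ^ 3 < pt u j
        else univ.filter fun j => pt u j < 1 / L ^ 2)
  let S : V → Finset V := fun v => {u | IsRNbr G r v u}
  obtain ⟨s, rfl⟩ : ∃ s, r = s + 1 := ⟨r - 1, by omega⟩
  have hS : ∀ v, (#(S v) : ℝ) ≤ G.degree v * (G.maxDegree : ℝ) ^ s := fun v => by
    exact_mod_cast card_isRNbr_le G v s
  have hMN : ∀ v, G.degree v * (G.maxDegree : ℝ) ^ s ≤ N := fun v => by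
    rw [hNdef, pow_succ']
    push_cast
    gcongr
    exact G.degree_le_maxDegree v
  obtain ⟨ω, hω⟩ := exists_forall_concentrated hN S (fun v => G.neighborFinset v)
    (fun v u hu => by
      have h := SimpleGraph.dist_eq_one_iff_adj.2 ((SimpleGraph.mem_neighborFinset _ _ _).1 hu)
      exact Finset.mem_filter.2 ⟨Finset.mem_univ _, by omega, by omega⟩)
    (fun u v h => by
      have h := (Finset.mem_filter.1 h).2
      refine Finset.mem_filter.2 ⟨Finset.mem_univ _, ?_⟩
      rwa [IsRNbr, SimpleGraph.dist_comm])
    (fun v => G.degree v * (G.maxDegree : ℝ) ^ s) hS hMN x P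
    (fun v t u => by
      rcases t with k | _ | _
      · exact hbelow _ (hpt0 v k) (hpt1 v k) u
      · exact hbelow _ (by positivity) hL2 u
      · exact habove _ (by positivity) hL3 u)
    (L := L) (by linarith) (by simp)
    (by rw [hNexp]; exact thirty_six_mul_exp_le_one hr1 hL)
  simp only [SimpleGraph.card_neighborFinset_eq_degree] at hω
  have hncard : ∀ (v : V) (t : Fin N ⊕ Bool) (Q : V → Prop), (∀ u, Q u ↔ ω u ∈ P v t u) →
      {u | Q u ∧ IsRNbr G (s + 1) v u}.ncard = #{u ∈ S v | ω u ∈ P v t u} := fun v t Q hQ => by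
    rw [← Set.ncard_coe_finset]
    congr 1
    ext u
    simp [S, and_comm, hQ]
  have hncard' : ∀ (v : V) (t : Fin N ⊕ Bool) (Q : V → Prop), (∀ u, Q u ↔ ω u ∈ P v t u) →
      {u | Q u ∧ G.Adj v u}.ncard = #{u ∈ G.neighborFinset v | ω u ∈ P v t u} :=
    fun v t Q hQ => by
      rw [← Set.ncard_coe_finset]
      congr 1
      ext u
      simp [and_comm, hQ]
  refine ⟨fun v => pt v (ω v), fun u v h => hpt_inj _ _ _ _ h,
    fun v => ⟨hpt0 _ _, hpt1 _ _⟩, fun v => ?_⟩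
  have hMd : (G.degree v : ℝ) ≤ G.degree v * (G.maxDegree : ℝ) ^ s :=
    le_mul_of_one_le_right (Nat.cast_nonneg _) (one_le_pow₀ (by exact_mod_cast hΔnat))
  have hA4 : 4 * L ^ 2 ≤ 1 / L ^ 2 * G.degree v := by
    rw [one_div, ← div_eq_inv_mul, le_div_iff₀ (by positivity)]
    refine le_trans ?_ (hd v)
    calc 4 * L ^ 2 * L ^ 2 = 4 * L ^ 4 := by ring
      _ ≤ L ^ 4 * L ^ 4 := by
          gcongr
          calc (4 : ℝ) ≤ 20 ^ 4 := by norm_num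
            _ ≤ L ^ 4 := by gcongr
      _ = L ^ 8 := by ring
  have hC4 : 4 * L ^ 2 ≤ 1 / L ^ 3 * G.degree v := by
    rw [one_div, ← div_eq_inv_mul, le_div_iff₀ (by positivity)]
    refine le_trans ?_ (hd v)
    calc 4 * L ^ 2 * L ^ 3 = 4 * L ^ 5 := by ring
      _ ≤ L ^ 3 * L ^ 5 := by
          gcongr
          calc (4 : ℝ) ≤ 20 ^ 3 := by norm_num
            _ ≤ L ^ 3 := by gcongr
      _ = L ^ 8 := by ring
  have hLsq : L ^ 2 ≤ 4 * L ^ 2 := by nlinarith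
  have hAM : 4 * L ^ 2 ≤ 1 / L ^ 2 * (G.degree v * (G.maxDegree : ℝ) ^ s) :=
    hA4.trans (by gcongr)
  have hCM : 4 * L ^ 2 ≤ 1 / L ^ 3 * (G.degree v * (G.maxDegree : ℝ) ^ s) :=
    hC4.trans (by gcongr)
  have hA := hω v (Sum.inr false) (hLsq.trans hA4)
  have hC := hω v (Sum.inr true) (hLsq.trans hC4)
  simp only [x, Sum.elim_inr, cond_true, cond_false] at hA hC
  have eA := sqrt_mul_le_half hA4
  have eC := sqrt_mul_le_half hC4
  have eAM := sqrt_mul_le_half hAM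
  have eCM := sqrt_mul_le_half hCM
  have hB := fun h : 1 / L ^ 2 ≤ pt v (ω v) =>
    hω v (Sum.inl (ω v)) ((hLsq.trans hA4).trans (by simp only [x, Sum.elim_inl]; gcongr))
  simp only [x, Sum.elim_inl] at hB
  have hmemA : ∀ u, pt u (ω u) < 1 / L ^ 2 ↔ ω u ∈ P v (Sum.inr false) u := fun u => by simp [P]
  have hmemC : ∀ u, 1 - 1 / L ^ 3 < pt u (ω u) ↔ ω u ∈ P v (Sum.inr true) u := fun u => by
    simp [P]
  have hmemB : ∀ u, pt u (ω u) < pt v (ω v) ↔ ω u ∈ P v (Sum.inl (ω v)) u := fun u => by simp [P]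
  have hdiv : ∀ a b : ℝ, 2 * a / b = 2 * (1 / b * a) := fun a b => by ring
  have hdiv' : ∀ a b : ℝ, 1 / 2 * a / b = 1 / 2 * (1 / b * a) := fun a b => by ring
  simp only [Set.mem_ofPred_eq, Nat.add_sub_cancel]
  rw [hncard v _ _ hmemA, hncard v _ _ hmemC, hncard' v _ _ hmemA, hncard' v _ _ hmemC]
  simp only [and_comm (a := G.Adj v _), and_comm (a := IsRNbr G _ v _)]
  rw [hncard v _ _ hmemB, hncard' v _ _ hmemB, mul_assoc, mul_assoc (pt v (ω v)), hdiv, hdiv, hdiv,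
    hdiv, hdiv', hdiv']
  refine ⟨?_, ?_, ⟨?_, ?_⟩, ⟨?_, ?_⟩, fun h => (hB h.1).2.2, fun h => (hB h.1).1⟩
  all_goals linarith [hA.1, hA.2.1, hA.2.2, hC.1, hC.2.1, hC.2.2]
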